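/- arXiv:2007.06326 — 2 statements merged into one kernel-verified Lean document; each statement's English description precedes it below -/
import Mathlib

section
/- Let Λ be a nonempty finite set, p a probability vector on Λ with strictly positive entries, Ω = Λ^ℤ, β = p^ℤ the Bernoulli measure on Ω, and σ : Ω → Ω the left shift. Let π : Ω → P(V) be measurable and depend only on the coordinates (ω_n)_{n≥0}, and let y : Ω → V be measurable with |y(ω)| = 1 for all ω and depend only on the coordinates (ω_n)_{n<0}. Suppose there exist C ≥ 1 and 0 < α ≤ 1 such that for every unit vector y₀ ∈ V and every r > 0, β{ω : d(π(ω), P(y₀^⊥)) ≤ r} ≤ C r^α. Then for β-a.e. ω ∈ Ω, (1/n) · log d(π(σⁿω), P(y(σⁿω)^⊥)) → 0 as n → ∞. -/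
open MeasureTheory Filter
open scoped RealInnerProductSpace ENNReal

variable {V : Type*} [NormedAddCommGroup V] [InnerProductSpace ℝ V]

/-- The projective distance between the lines spanned by two nonzero vectors:
`d(x̄, ȳ) = (1 − ⟨x,y⟫²/(|x|²|y|²))^{1/2}`. -/
noncomputable def projDist (x y : V) : ℝ :=
  Real.sqrt (1 - ⟪x, y⟫ ^ 2 / (‖x‖ ^ 2 * ‖y‖ ^ 2))

/-- The distance `d(x̄, P(W))` from the line spanned by `x` to the projective space of the
submodule `W`. -/
noncomputable def projDistToSub (x : V) (W : Submodule ℝ V) : ℝ :=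
  sInf {r : ℝ | ∃ y : V, y ∈ W ∧ y ≠ 0 ∧ r = projDist x y}

/-- The (Borel) measurable structure on the projective space `ℙ ℝ V`, obtained as a quotient
of the space of nonzero vectors. -/
noncomputable instance projMeasurableSpace [MeasurableSpace V] :
    MeasurableSpace (Projectivization ℝ V) :=
  Quotient.instMeasurableSpace

/-- The left shift on two-sided sequences: `(σω)_n = ω_{n+1}`. -/
def shift {Λ : Type*} (ω : ℤ → Λ) : ℤ → Λ := fun n => ω (n + 1)


lemma aux_projDistToSub [FiniteDimensional ℝ V] (hdim : 2 ≤ Module.finrank ℝ V)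
    (x y : V) (hx : x ≠ 0) (hy : ‖y‖ = 1) :
    projDistToSub x (Submodule.span ℝ {y})ᗮ = |⟪x, y⟫| / ‖x‖ := by
  have hxn : 0 < ‖x‖ := norm_pos_iff.mpr hx
  have hyy : ⟪y, y⟫ = (1 : ℝ) := by rw [real_inner_self_eq_norm_sq, hy]; norm_num
  have hmem : ∀ z : V, z ∈ (Submodule.span ℝ {y})ᗮ ↔ ⟪y, z⟫ = (0 : ℝ) := fun z =>
    Submodule.mem_orthogonal_singleton_iff_inner_right
  set w : V := x - (⟪x, y⟫ : ℝ) • y with hw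
  have hwy : ⟪y, w⟫ = (0 : ℝ) := by
    rw [hw, inner_sub_right, inner_smul_right, hyy, real_inner_comm]; ring
  have hxw : ∀ z : V, ⟪y, z⟫ = (0 : ℝ) → ⟪x, z⟫ = (⟪w, z⟫ : ℝ) := by
    intro z hz
    rw [hw, inner_sub_left, real_inner_smul_left, hz]; ring
  have hww : ‖w‖ ^ 2 = ‖x‖ ^ 2 - (⟪x, y⟫ : ℝ) ^ 2 := by
    rw [← real_inner_self_eq_norm_sq w, ← hxw w hwy, hw, inner_sub_right, inner_smul_right,
      real_inner_self_eq_norm_sq]; ring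
  have hsq : |⟪x, y⟫| / ‖x‖ = Real.sqrt ((⟪x, y⟫ : ℝ) ^ 2 / ‖x‖ ^ 2) := by
    rw [← div_pow, Real.sqrt_sq_eq_abs, abs_div, abs_of_pos hxn]
  unfold projDistToSub
  refine IsLeast.csInf_eq ⟨?_, ?_⟩
  · by_cases hw0 : w = 0
    · have hne : (Submodule.span ℝ {y})ᗮ ≠ ⊥ := by
        intro h
        have h1 := Submodule.finrank_add_finrank_orthogonal (Submodule.span ℝ {y})
        rw [h, finrank_bot] at h1
        have h2 := finrank_span_le_card (R := ℝ) ({y} : Set V)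
        simp at h2
        omega
      obtain ⟨z, hz, hz0⟩ := Submodule.exists_mem_ne_zero_of_ne_bot hne
      refine ⟨z, hz, hz0, ?_⟩
      rw [hsq, projDist, hxw z ((hmem z).1 hz), hw0, inner_zero_left]
      rw [hw0, norm_zero] at hww
      have h3 : (⟪x, y⟫ : ℝ) ^ 2 = ‖x‖ ^ 2 := by linarith
      rw [h3, div_self (by positivity)]; norm_num
    · refine ⟨w, (hmem w).2 hwy, hw0, ?_⟩
      have hwn : 0 < ‖w‖ := norm_pos_iff.mpr hw0
      rw [hsq, projDist, hxw w hwy, real_inner_self_eq_norm_sq]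
      congr 1
      have h3 : (⟪x, y⟫ : ℝ) ^ 2 = ‖x‖ ^ 2 - ‖w‖ ^ 2 := by linarith
      rw [h3]
      field_simp
  · rintro r ⟨z, hz, hz0, rfl⟩
    have hzn : 0 < ‖z‖ := norm_pos_iff.mpr hz0
    rw [hsq, projDist]
    apply Real.sqrt_le_sqrt
    rw [hxw z ((hmem z).1 hz)]
    have h4 : (⟪w, z⟫ : ℝ) ^ 2 ≤ ‖w‖ ^ 2 * ‖z‖ ^ 2 := by
      rw [← mul_pow, ← sq_abs]
      exact pow_le_pow_left₀ (abs_nonneg _) (abs_real_inner_le_norm w z) 2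
    rw [le_sub_iff_add_le, hww] at *
    have h5 : (⟪w, z⟫ : ℝ) ^ 2 / (‖x‖ ^ 2 * ‖z‖ ^ 2) ≤
        (‖x‖ ^ 2 - (⟪x, y⟫ : ℝ) ^ 2) / ‖x‖ ^ 2 := by
      rw [div_le_div_iff₀ (by positivity) (by positivity)]
      nlinarith [sq_nonneg ‖x‖]
    have h6 : (‖x‖ ^ 2 - (⟪x, y⟫ : ℝ) ^ 2) / ‖x‖ ^ 2 = 1 - (⟪x, y⟫ : ℝ) ^ 2 / ‖x‖ ^ 2 := by
      rw [sub_div, div_self (by positivity)]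
    linarith

lemma aux_ext {Λ : Type*} [Fintype Λ] [MeasurableSpace Λ] [MeasurableSingletonClass Λ]
    (μ ν : Measure (ℤ → Λ)) [IsProbabilityMeasure μ] [IsProbabilityMeasure ν]
    (h : ∀ (n : ℕ) (a : ℤ → Λ),
      μ {ω | ∀ j ∈ Finset.Icc (-(n + 1) : ℤ) n, ω j = a j} =
      ν {ω | ∀ j ∈ Finset.Icc (-(n + 1) : ℤ) n, ω j = a j}) : μ = ν := by
  classical
  let K : Set (Set (ℤ → Λ)) := {s | ∃ (n : ℕ) (a : ℤ → Λ),
    s = {ω | ∀ j ∈ Finset.Icc (-(n + 1) : ℤ) n, ω j = a j}}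
  have hKm : ∀ s ∈ K, MeasurableSet s := by
    rintro s ⟨n, a, rfl⟩
    have : {ω : ℤ → Λ | ∀ j ∈ Finset.Icc (-(n + 1) : ℤ) n, ω j = a j} =
        ⋂ j ∈ Finset.Icc (-(n + 1) : ℤ) n, (fun ω : ℤ → Λ => ω j) ⁻¹' {a j} := by
      ext ω; simp
    rw [this]
    exact Finset.measurableSet_biInter _ fun j _ =>
      measurable_pi_apply j (measurableSet_singleton _)
  refine ext_of_generate_finite K ?_ ?_ ?_ (by simp)
  · apply le_antisymm
    · refine iSup_le fun i => ?_
      rw [← measurable_iff_comap_le]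
      refine @measurable_to_countable' _ _ _ _ (MeasurableSpace.generateFrom K) _ fun l => ?_
      let n : ℕ := i.natAbs
      have hi : i ∈ Finset.Icc (-(n + 1) : ℤ) n := by
        simp only [Finset.mem_Icc, n]; omega
      have : (fun ω : ℤ → Λ => ω i) ⁻¹' {l} =
          ⋃ a ∈ {a : Finset.Icc (-(n + 1) : ℤ) n → Λ | a ⟨i, hi⟩ = l},
            {ω : ℤ → Λ | ∀ j ∈ Finset.Icc (-(n + 1) : ℤ) n,
              ω j = (fun k : ℤ => if hk : k ∈ Finset.Icc (-(n + 1) : ℤ) n then a ⟨k, hk⟩ else l) j} := by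
        ext ω
        simp only [Set.mem_preimage, Set.mem_singleton_iff, Set.mem_iUnion, Set.mem_setOf_eq,
          exists_prop]
        constructor
        · intro h
          refine ⟨fun j => ω j, h, fun j hj => ?_⟩
          rw [dif_pos hj]
        · rintro ⟨a, ha, h⟩
          have := h i hi
          rw [dif_pos hi] at this
          rw [this, ha]
      rw [this]
      exact MeasurableSet.biUnion (Set.to_countable _) fun a _ =>
        MeasurableSpace.measurableSet_generateFrom ⟨n, _, rfl⟩
    · exact MeasurableSpace.generateFrom_le hKm
  · rintro s ⟨n, a, rfl⟩ t ⟨m, b, rfl⟩ ⟨ω₀, h1, h2⟩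
    refine ⟨max n m, ω₀, ?_⟩
    ext ω
    simp only [Set.mem_inter_iff, Set.mem_setOf_eq, Finset.mem_Icc] at *
    push_cast
    constructor
    · rintro ⟨h3, h4⟩ j hj
      rcases le_total n m with hnm | hnm
      · rw [h4 j (by omega), h2 j (by omega)]
      · rw [h3 j (by omega), h1 j (by omega)]
    · intro h
      exact ⟨fun j hj => by rw [h j (by omega), h1 j hj],
        fun j hj => by rw [h j (by omega), h2 j hj]⟩
  · rintro s ⟨n, a, rfl⟩
    exact h n a

lemma aux_shift_measurable {Λ : Type*} [MeasurableSpace Λ] :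
    Measurable (shift : (ℤ → Λ) → ℤ → Λ) :=
  measurable_pi_lambda _ fun n => measurable_pi_apply (n + 1)

lemma aux_shift {Λ : Type*} [Fintype Λ] [MeasurableSpace Λ] [MeasurableSingletonClass Λ]
    (p : Λ → ℝ)
    (β : Measure (ℤ → Λ)) [IsProbabilityMeasure β]
    (hβ : ∀ m n : ℤ, m ≤ n → ∀ a : ℤ → Λ,
      β {ω | ∀ j ∈ Finset.Icc m n, ω j = a j} =
        ENNReal.ofReal (∏ j ∈ Finset.Icc m n, p (a j))) :
    MeasurePreserving (shift : (ℤ → Λ) → ℤ → Λ) β β := by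
  refine ⟨aux_shift_measurable, ?_⟩
  haveI : IsProbabilityMeasure (β.map (shift : (ℤ → Λ) → ℤ → Λ)) :=
    Measure.isProbabilityMeasure_map aux_shift_measurable.aemeasurable
  refine aux_ext _ _ fun n a => ?_
  rw [Measure.map_apply aux_shift_measurable, hβ _ _ (by omega)]
  · have : (shift : (ℤ → Λ) → ℤ → Λ) ⁻¹' {ω | ∀ j ∈ Finset.Icc (-(n + 1) : ℤ) n, ω j = a j} =
        {ω | ∀ j ∈ Finset.Icc (-(n + 1) + 1 : ℤ) (n + 1), ω j = (fun k => a (k - 1)) j} := by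
      ext ω
      simp only [Set.mem_preimage, Set.mem_setOf_eq, Finset.mem_Icc, shift]
      constructor
      · intro h j hj
        have := h (j - 1) (by omega)
        rwa [sub_add_cancel] at this
      · intro h j hj
        have := h (j + 1) (by omega)
        rwa [add_sub_cancel_right] at this
    rw [this, hβ _ _ (by omega)]
    congr 1
    refine Finset.prod_bij' (fun j _ => j - 1) (fun j _ => j + 1) ?_ ?_ ?_ ?_ ?_
    all_goals simp only [Finset.mem_Icc]
    all_goals intros
    all_goals first | omega | trivial
  · have : {ω : ℤ → Λ | ∀ j ∈ Finset.Icc (-(n + 1) : ℤ) n, ω j = a j} =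
        ⋂ j ∈ Finset.Icc (-(n + 1) : ℤ) n, (fun ω : ℤ → Λ => ω j) ⁻¹' {a j} := by
      ext ω; simp
    rw [this]
    exact Finset.measurableSet_biInter _ fun j _ =>
      measurable_pi_apply j (measurableSet_singleton _)

/-- Glue the past of the first sequence with the future of the second one. -/
def auxGlue {Λ : Type*} (q : (ℤ → Λ) × (ℤ → Λ)) : ℤ → Λ :=
  fun n => if n < 0 then q.1 n else q.2 n

lemma auxGlue_measurable {Λ : Type*} [MeasurableSpace Λ] :
    Measurable (auxGlue : (ℤ → Λ) × (ℤ → Λ) → ℤ → Λ) := by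
  refine measurable_pi_lambda _ fun n => ?_
  unfold auxGlue
  by_cases h : n < 0
  · simp only [h, if_true]
    exact (measurable_pi_apply n).comp measurable_fst
  · simp only [h, if_false]
    exact (measurable_pi_apply n).comp measurable_snd

lemma aux_glue {Λ : Type*} [Fintype Λ] [MeasurableSpace Λ] [MeasurableSingletonClass Λ]
    (p : Λ → ℝ) (hp : ∀ l, 0 < p l)
    (β : Measure (ℤ → Λ)) [IsProbabilityMeasure β]
    (hβ : ∀ m n : ℤ, m ≤ n → ∀ a : ℤ → Λ,
      β {ω | ∀ j ∈ Finset.Icc m n, ω j = a j} =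
        ENNReal.ofReal (∏ j ∈ Finset.Icc m n, p (a j))) :
    (β.prod β).map auxGlue = β := by
  haveI : IsProbabilityMeasure ((β.prod β).map (auxGlue (Λ := Λ))) :=
    Measure.isProbabilityMeasure_map auxGlue_measurable.aemeasurable
  refine aux_ext _ _ fun n a => ?_
  rw [Measure.map_apply auxGlue_measurable, hβ _ _ (by omega)]
  · have : auxGlue ⁻¹' {ω : ℤ → Λ | ∀ j ∈ Finset.Icc (-(n + 1) : ℤ) n, ω j = a j} =
        {ω | ∀ j ∈ Finset.Icc (-(n + 1) : ℤ) (-1), ω j = a j} ×ˢ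
        {ω | ∀ j ∈ Finset.Icc (0 : ℤ) n, ω j = a j} := by
      ext ⟨ω, ω'⟩
      simp only [Set.mem_preimage, Set.mem_setOf_eq, Finset.mem_Icc, auxGlue, Set.mem_prod]
      constructor
      · intro h
        refine ⟨fun j hj => ?_, fun j hj => ?_⟩
        · have := h j (by omega)
          rwa [if_pos (by omega)] at this
        · have := h j (by omega)
          rwa [if_neg (by omega)] at this
      · rintro ⟨h1, h2⟩ j hj
        split_ifs with h
        · exact h1 j (by omega)
        · exact h2 j (by omega)
    rw [this, Measure.prod_prod, hβ _ _ (by omega), hβ _ _ (by omega),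
      ← ENNReal.ofReal_mul (Finset.prod_nonneg fun j _ => (hp _).le)]
    congr 1
    rw [← Finset.prod_union]
    · congr 1
      ext j
      simp only [Finset.mem_union, Finset.mem_Icc]
      omega
    · rw [Finset.disjoint_left]
      intro j
      simp only [Finset.mem_Icc]
      omega
  · have : {ω : ℤ → Λ | ∀ j ∈ Finset.Icc (-(n + 1) : ℤ) n, ω j = a j} =
        ⋂ j ∈ Finset.Icc (-(n + 1) : ℤ) n, (fun ω : ℤ → Λ => ω j) ⁻¹' {a j} := by
      ext ω; simp
    rw [this]
    exact Finset.measurableSet_biInter _ fun j _ =>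
      measurable_pi_apply j (measurableSet_singleton _)

/-- The closed form of the distance to the hyperplane. -/
noncomputable def auxG (ℓ : Projectivization ℝ V) (v : V) : ℝ := |⟪ℓ.rep, v⟫| / ‖ℓ.rep‖

lemma auxG_measurable [FiniteDimensional ℝ V] [MeasurableSpace V] [BorelSpace V] (v : V) :
    Measurable (fun ℓ : Projectivization ℝ V => auxG ℓ v) := by
  refine measurable_from_quotient.2 ?_
  change Measurable fun x : {x : V // x ≠ 0} => auxG (Projectivization.mk ℝ (x : V) x.2) v
  have : (fun x : {x : V // x ≠ 0} => auxG (Projectivization.mk ℝ (x : V) x.2) v) =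
      fun x : {x : V // x ≠ 0} => |(⟪(x : V), v⟫ : ℝ)| / ‖(x : V)‖ := by
    funext x
    obtain ⟨a, ha⟩ := Projectivization.exists_smul_eq_mk_rep ℝ (x : V) x.2
    have ha' : (a : ℝ) • (x : V) = (Projectivization.mk ℝ (x : V) x.2).rep := ha
    have ha0 : |(a : ℝ)| ≠ 0 := abs_ne_zero.2 a.ne_zero
    rw [auxG, ← ha', real_inner_smul_left, norm_smul, abs_mul, Real.norm_eq_abs,
      mul_div_mul_left _ _ ha0]
  rw [this]
  have hc : Continuous fun x : V => |(⟪x, v⟫ : ℝ)| := by fun_prop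
  exact (hc.measurable.comp measurable_subtype_coe).div
    (measurable_norm.comp measurable_subtype_coe)

lemma auxG_measurable2 [FiniteDimensional ℝ V] [MeasurableSpace V] [BorelSpace V]
    {Ω : Type*} [MeasurableSpace Ω] (f : Ω → Projectivization ℝ V) (hf : Measurable f)
    (g : Ω → V) (hg : Measurable g) : Measurable (fun ω => auxG (f ω) (g ω)) := by
  have h : Measurable (Function.uncurry fun (v : V) (ω : Ω) => auxG (f ω) v) := by
    refine measurable_uncurry_of_continuous_of_measurable (fun ω => ?_) (fun v => ?_)
    · unfold auxG; fun_prop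
    · exact (auxG_measurable v).comp hf
  exact h.comp (hg.prodMk measurable_id)

lemma aux_limit (D : ℕ → ℝ) (hD : ∀ n, D n ≤ 1)
    (h : ∀ k : ℕ, ∀ᶠ n : ℕ in atTop, Real.exp (-(1 / ((k : ℝ) + 1)) * n) < D n) :
    Tendsto (fun n : ℕ => (n : ℝ)⁻¹ * Real.log (D n)) atTop (nhds 0) := by
  rw [Metric.tendsto_atTop']
  intro ε hε
  obtain ⟨k, hk⟩ := exists_nat_one_div_lt hε
  obtain ⟨N, hN⟩ := eventually_atTop.1 (h k)
  refine ⟨N, fun n hn => ?_⟩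
  have h1 := hN n hn.le
  have hn0 : (0 : ℝ) < n := by exact_mod_cast (Nat.zero_le N).trans_lt hn
  have hpos : 0 < D n := (Real.exp_pos _).trans h1
  have h2 : Real.log (D n) ≤ 0 := Real.log_nonpos hpos.le (hD n)
  have h3 := (Real.lt_log_iff_exp_lt hpos).2 h1
  rw [Real.dist_eq, sub_zero, abs_of_nonpos (mul_nonpos_of_nonneg_of_nonpos (by positivity) h2),
    inv_mul_eq_div, ← neg_div, div_lt_iff₀ hn0]
  nlinarith

/-- Lemma 3.2 of the paper. Under the Bernoulli measure `β = p^ℤ`, if the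
distribution of `π` satisfies the regularity bound
`β{ω : d(π(ω), P(y₀^⊥)) ≤ r} ≤ C r^α` uniformly over unit vectors `y₀`, with `π` depending
only on the nonnegative coordinates and the unit vector `y(ω)` only on the negative ones,
then for `β`-a.e. `ω`, `(1/n)·log d(π(σⁿω), P(y(σⁿω)^⊥)) → 0`. -/
theorem stmt3 [FiniteDimensional ℝ V] (hdim : 2 ≤ Module.finrank ℝ V)
    [MeasurableSpace V] [BorelSpace V]
    {Λ : Type*} [Fintype Λ] [Nonempty Λ] [MeasurableSpace Λ] [MeasurableSingletonClass Λ]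
    (p : Λ → ℝ) (hp : ∀ l, 0 < p l) (hp1 : ∑ l, p l = 1)
    (β : Measure (ℤ → Λ)) [IsProbabilityMeasure β]
    (hβ : ∀ m n : ℤ, m ≤ n → ∀ a : ℤ → Λ,
      β {ω | ∀ j ∈ Finset.Icc m n, ω j = a j} =
        ENNReal.ofReal (∏ j ∈ Finset.Icc m n, p (a j)))
    (π : (ℤ → Λ) → Projectivization ℝ V) (hπ : Measurable π)
    (hπ0 : ∀ ω ω' : ℤ → Λ, (∀ n : ℤ, 0 ≤ n → ω n = ω' n) → π ω = π ω')
    (y : (ℤ → Λ) → V) (hy : Measurable y) (hy1 : ∀ ω, ‖y ω‖ = 1)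
    (hy0 : ∀ ω ω' : ℤ → Λ, (∀ n : ℤ, n < 0 → ω n = ω' n) → y ω = y ω')
    (C : ℝ) (hC : 1 ≤ C) (α : ℝ) (hα0 : 0 < α) (hα1 : α ≤ 1)
    (hreg : ∀ y₀ : V, ‖y₀‖ = 1 → ∀ r : ℝ, 0 < r →
      β {ω | projDistToSub (π ω).rep (Submodule.span ℝ {y₀})ᗮ ≤ r} ≤
        ENNReal.ofReal (C * r ^ α)) :
    ∀ᵐ ω ∂β, Tendsto (fun n : ℕ =>
        (n : ℝ)⁻¹ * Real.log (projDistToSub (π (shift^[n] ω)).rep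
          (Submodule.span ℝ {y (shift^[n] ω)})ᗮ))
      atTop (nhds 0) := by
  have hform : ∀ ω ω', projDistToSub (π ω).rep (Submodule.span ℝ {y ω'})ᗮ =
      auxG (π ω) (y ω') := fun ω ω' =>
    aux_projDistToSub hdim _ _ (π ω).rep_nonzero (hy1 ω')
  have hGm : Measurable fun ω => auxG (π ω) (y ω) := auxG_measurable2 π hπ y hy
  have hle : ∀ ω, auxG (π ω) (y ω) ≤ 1 := by
    intro ω
    unfold auxG
    refine div_le_one_of_le₀ ?_ (norm_nonneg _)
    have := abs_real_inner_le_norm (π ω).rep (y ω)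
    rwa [hy1, mul_one] at this
  have hmain : ∀ r : ℝ, 0 < r →
      β {ω | auxG (π ω) (y ω) ≤ r} ≤ ENNReal.ofReal (C * r ^ α) := by
    intro r hr
    have hE : MeasurableSet {ω | auxG (π ω) (y ω) ≤ r} := measurableSet_le hGm measurable_const
    conv_lhs => rw [← aux_glue p hp β hβ]
    rw [Measure.map_apply auxGlue_measurable hE, Measure.prod_apply (auxGlue_measurable hE)]
    calc _ ≤ ∫⁻ _, ENNReal.ofReal (C * r ^ α) ∂β := by
          refine lintegral_mono fun ω => ?_
          refine le_trans (le_of_eq ?_) (hreg (y ω) (hy1 ω) r hr)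
          congr 1
          ext ω'
          have e1 : π (auxGlue (ω, ω')) = π ω' := hπ0 _ _ fun n hn => by
            simp [auxGlue, not_lt.2 hn]
          have e2 : y (auxGlue (ω, ω')) = y ω := hy0 _ _ fun n hn => by
            simp [auxGlue, hn]
          simp only [Set.mem_preimage, Set.mem_setOf_eq, e1, e2, hform]
      _ = _ := by simp
  have hmp := aux_shift p β hβ
  have hBC : ∀ k : ℕ, ∀ᵐ ω ∂β, ∀ᶠ n : ℕ in atTop,
      Real.exp (-(1 / ((k : ℝ) + 1)) * n) < auxG (π (shift^[n] ω)) (y (shift^[n] ω)) := by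
    intro k
    have hk : (0 : ℝ) < 1 / ((k : ℝ) + 1) := by positivity
    have hb : ∀ n : ℕ, β {ω | auxG (π (shift^[n] ω)) (y (shift^[n] ω)) ≤
        Real.exp (-(1 / ((k : ℝ) + 1)) * n)} ≤
        ENNReal.ofReal (C * Real.exp (n * (-(1 / ((k : ℝ) + 1)) * α))) := by
      intro n
      have hE : MeasurableSet {ω | auxG (π ω) (y ω) ≤ Real.exp (-(1 / ((k : ℝ) + 1)) * n)} :=
        measurableSet_le hGm measurable_const
      have h1 := (hmp.iterate n).measure_preimage hE.nullMeasurableSet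
      refine (le_of_eq h1).trans ((hmain _ (Real.exp_pos _)).trans (le_of_eq ?_))
      rw [← Real.exp_mul]
      congr 3
      ring
    have hs : Summable fun n : ℕ => C * Real.exp (n * (-(1 / ((k : ℝ) + 1)) * α)) :=
      (Real.summable_exp_nat_mul_iff.2 (by nlinarith)).mul_left C
    have hfin : ∑' n : ℕ, β {ω | auxG (π (shift^[n] ω)) (y (shift^[n] ω)) ≤
        Real.exp (-(1 / ((k : ℝ) + 1)) * n)} ≠ ∞ :=
      ne_top_of_le_ne_top hs.tsum_ofReal_ne_top (ENNReal.tsum_le_tsum hb)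
    filter_upwards [ae_eventually_notMem hfin] with ω hω
    filter_upwards [hω] with n hn
    simpa using hn
  filter_upwards [ae_all_iff.2 hBC] with ω hω
  simp only [hform]
  exact aux_limit _ (fun n => hle _) hω
end

section
/- Let (X, B, ρ) be a standard Borel probability space, let T : X → X be an invertible measure-preserving transformation, let 𝒫 be a finite measurable partition of X, and let F be a sub-σ-algebra of B such that T^{-1}F equals F ∨ σ(𝒫) modulo ρ-null sets. Writing 𝒫₀^{n-1} = ⋁_{j=0}^{n-1} T^{-j}𝒫, the following hold: (1) for every n ≥ 1, I_ρ(𝒫₀^{n-1} | F) = Σ_{j=0}^{n-1} I_ρ(𝒫 | F) ∘ T^j ρ-a.e.; (2) if in addition T is ergodic, then (1/n) · I_ρ(𝒫₀^{n-1} | F)(x) → H_ρ(𝒫 | F) for ρ-a.e. x as n → ∞. -/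
open MeasureTheory Filter

/-- The conditional information function `I_ρ(𝒫 | F)` of a finite measurable partition
`P : ι → Set X` given a sub-σ-algebra `F`:
`I_ρ(𝒫|F)(x) = −Σ_i 1_{P i}(x) · log E_ρ[1_{P i} | F](x)`. -/
noncomputable def condInfo {X : Type*} {m0 : MeasurableSpace X} (ρ : Measure X)
    (F : MeasurableSpace X) {ι : Type*} [Fintype ι] (P : ι → Set X) (x : X) : ℝ :=
  -∑ i, Set.indicator (P i)
      (fun _ => Real.log ((ρ[(P i).indicator (fun _ => (1 : ℝ)) | F]) x)) x


/-- Running maxima of Birkhoff sums, defined recursively. -/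
noncomputable def runMax {X : Type*} (T : X → X) (g : X → ℝ) : ℕ → X → ℝ
  | 0 => fun _ => 0
  | n + 1 => fun x => max 0 (g x + runMax T g n (T x))

lemma runMax_nonneg {X : Type*} (T : X → X) (g : X → ℝ) (n : ℕ) (x : X) :
    0 ≤ runMax T g n x := by
  cases n with
  | zero => exact le_rfl
  | succ n => exact le_max_left _ _

lemma runMax_le_succ {X : Type*} (T : X → X) (g : X → ℝ) (n : ℕ) :
    ∀ x : X, runMax T g n x ≤ runMax T g (n + 1) x := by
  induction n with
  | zero => intro x; exact runMax_nonneg T g 1 x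
  | succ n ih =>
    intro x
    have := ih (T x)
    simp only [runMax] at this ⊢
    gcongr

lemma runMax_mono {X : Type*} (T : X → X) (g : X → ℝ) (x : X) :
    Monotone (fun n => runMax T g n x) :=
  monotone_nat_of_le_succ fun n => runMax_le_succ T g n x

lemma sum_le_runMax {X : Type*} (T : X → X) (g : X → ℝ) (n : ℕ) :
    ∀ x : X, ∑ j ∈ Finset.range n, g (T^[j] x) ≤ runMax T g n x := by
  induction n with
  | zero => intro x; simp [runMax]
  | succ n ih =>
    intro x
    rw [Finset.sum_range_succ']
    have := ih (T x)
    simp only [Function.iterate_succ, Function.comp, Function.iterate_zero, id] at this ⊢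
    refine le_trans ?_ (le_max_right _ _)
    linarith

lemma runMax_measurable {X : Type*} {mX : MeasurableSpace X} {T : X → X} (hT : Measurable T)
    {g : X → ℝ} (hg : Measurable g) (n : ℕ) : Measurable (runMax T g n) := by
  induction n with
  | zero => exact measurable_const
  | succ n ih => exact measurable_const.max (hg.add (ih.comp hT))

lemma runMax_integrable {X : Type*} {mX : MeasurableSpace X} {ρ : Measure X}
    {T : X → X} (hT : MeasurePreserving T ρ ρ)
    {g : X → ℝ} (hg : Integrable g ρ) (n : ℕ) : Integrable (runMax T g n) ρ := by
  induction n with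
  | zero => exact integrable_zero _ _ _
  | succ n ih =>
    have h1 : Integrable (fun x => g x + runMax T g n (T x)) ρ :=
      hg.add (hT.integrable_comp_of_integrable ih)
    exact (integrable_zero X ℝ ρ).sup h1

lemma runMax_bdd_of_neg {X : Type*} {mX : MeasurableSpace X} {ρ : Measure X}
    [IsProbabilityMeasure ρ] {T : X → X} (hT : Ergodic T ρ)
    {g : X → ℝ} (hgm : Measurable g) (hg : Integrable g ρ) (hneg : ∫ x, g x ∂ρ < 0) :
    ∀ᵐ x ∂ρ, BddAbove (Set.range fun n => runMax T g n x) := by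
  have hmp := hT.toMeasurePreserving
  set B : Set X := {x | BddAbove (Set.range fun n => runMax T g n x)} with hB
  have hBm : MeasurableSet B :=
    measurableSet_bddAbove_range fun n => runMax_measurable hmp.measurable hgm n
  have hinv : T ⁻¹' B = B := by
    ext x
    simp only [hB, Set.mem_preimage, Set.mem_ofPred_eq]
    constructor
    · rintro ⟨C, hC⟩
      refine ⟨max 0 (g x + C), ?_⟩
      rintro _ ⟨n, rfl⟩
      refine (runMax_le_succ T g n x).trans ?_
      have : runMax T g n (T x) ≤ C := hC ⟨n, rfl⟩
      simp only [runMax]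
      gcongr
    · rintro ⟨C, hC⟩
      refine ⟨C - g x, ?_⟩
      rintro _ ⟨n, rfl⟩
      have : runMax T g (n+1) x ≤ C := hC ⟨n+1, rfl⟩
      have h2 := (le_max_right _ _).trans this
      simp only
      linarith
  rcases hT.toPreErgodic.ae_mem_or_ae_notMem hBm hinv with h | h
  · exact h
  exfalso
  have hlim : ∀ᵐ x ∂ρ, Tendsto (fun n => runMax T g (n+1) x - runMax T g n (T x)) atTop
      (nhds (g x)) := by
    filter_upwards [h] with x hx
    have hx' : T x ∉ B := by
      intro hh
      exact hx (hinv ▸ (show x ∈ T ⁻¹' B from hh))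
    have ht : Tendsto (fun n => runMax T g n (T x)) atTop atTop :=
      tendsto_atTop_atTop_of_monotone' (runMax_mono T g (T x)) hx'
    refine tendsto_const_nhds.congr' ?_
    filter_upwards [ht.eventually_ge_atTop (-g x)] with n hn
    simp only [runMax]
    rw [max_eq_right (by linarith)]
    ring
  have hInt := tendsto_integral_of_dominated_convergence (μ := ρ)
    (F := fun n x => runMax T g (n+1) x - runMax T g n (T x)) (f := g) (fun x => |g x|)
    (fun n => ((runMax_measurable hmp.measurable hgm (n+1)).sub
      ((runMax_measurable hmp.measurable hgm n).comp hmp.measurable)).aestronglyMeasurable)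
    hg.abs
    (fun n => Eventually.of_forall fun x => by
      have := runMax_nonneg T g n (T x)
      simp only [runMax, Real.norm_eq_abs]
      rcases max_cases 0 (g x + runMax T g n (T x)) with h | h
      · rw [h.1, zero_sub, abs_neg, abs_of_nonneg this]
        have := neg_abs_le (g x)
        have := h.2
        linarith
      · rw [h.1, add_sub_cancel_right])
    hlim
  have hpos : 0 ≤ ∫ x, g x ∂ρ := by
    refine ge_of_tendsto' hInt fun n => ?_
    have hi := runMax_integrable hmp hg n
    rw [integral_sub (g := fun a => runMax T g n (T a)) (runMax_integrable hmp hg (n+1))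
      (hmp.integrable_comp_of_integrable hi)]
    have he : ∫ x, runMax T g n (T x) ∂ρ = ∫ x, runMax T g n x ∂ρ := by
      rw [← integral_map (φ := T) (f := runMax T g n) hmp.measurable.aemeasurable
        (runMax_measurable hmp.measurable hgm n).aestronglyMeasurable, hmp.map_eq]
    rw [he, sub_nonneg]
    exact integral_mono hi (runMax_integrable hmp hg (n+1)) (runMax_le_succ T g n)
  linarith

lemma birkhoff_upper {X : Type*} {mX : MeasurableSpace X} {ρ : Measure X}
    [IsProbabilityMeasure ρ] {T : X → X} (hT : Ergodic T ρ)
    {f : X → ℝ} (hfm : Measurable f) (hf : Integrable f ρ) {c : ℝ} (hc : ∫ x, f x ∂ρ < c) :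
    ∀ᵐ x ∂ρ, ∀ᶠ n : ℕ in atTop, (n : ℝ)⁻¹ * ∑ j ∈ Finset.range n, f (T^[j] x) < c := by
  obtain ⟨d, hd1, hd2⟩ := exists_between hc
  have h := runMax_bdd_of_neg hT (g := fun x => f x - d) (hfm.sub_const d)
    (hf.sub (integrable_const d)) (by
      rw [integral_sub hf (integrable_const d)]; simp; linarith)
  filter_upwards [h] with x hx
  obtain ⟨C, hC⟩ := hx
  have ht : Tendsto (fun n : ℕ => (n : ℝ) * (c - d)) atTop atTop :=
    tendsto_natCast_atTop_atTop.atTop_mul_const (by linarith)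
  filter_upwards [ht.eventually_gt_atTop C, eventually_gt_atTop 0] with n hn hn0
  have h1 := (sum_le_runMax T (fun x => f x - d) n x).trans (hC ⟨n, rfl⟩)
  rw [Finset.sum_sub_distrib] at h1
  simp only [Finset.sum_const, Finset.card_range, nsmul_eq_mul] at h1
  have hn' : (0:ℝ) < n := by exact_mod_cast hn0
  rw [inv_mul_lt_iff₀ hn']
  linarith

lemma birkhoff_ergodic {X : Type*} {mX : MeasurableSpace X} {ρ : Measure X}
    [IsProbabilityMeasure ρ] {T : X → X} (hT : Ergodic T ρ)
    {f : X → ℝ} (hfm : Measurable f) (hf : Integrable f ρ) :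
    ∀ᵐ x ∂ρ, Tendsto (fun n : ℕ => (n : ℝ)⁻¹ * ∑ j ∈ Finset.range n, f (T^[j] x)) atTop
      (nhds (∫ x, f x ∂ρ)) := by
  have hU : ∀ᵐ x ∂ρ, ∀ k : ℕ, ∀ᶠ n : ℕ in atTop,
      (n : ℝ)⁻¹ * ∑ j ∈ Finset.range n, f (T^[j] x) < ∫ x, f x ∂ρ + 1 / ((k:ℝ) + 1) :=
    ae_all_iff.2 fun k => birkhoff_upper hT hfm hf (by
      have : 0 < 1 / ((k:ℝ) + 1) := by positivity
      linarith)
  have hL : ∀ᵐ x ∂ρ, ∀ k : ℕ, ∀ᶠ n : ℕ in atTop,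
      (n : ℝ)⁻¹ * ∑ j ∈ Finset.range n, -f (T^[j] x) < -∫ x, f x ∂ρ + 1 / ((k:ℝ) + 1) :=
    ae_all_iff.2 fun k => birkhoff_upper hT (f := fun x => -f x) hfm.neg hf.neg (by
      have : 0 < 1 / ((k:ℝ) + 1) := by positivity
      rw [integral_neg]
      linarith)
  filter_upwards [hU, hL] with x h1 h2
  rw [Metric.tendsto_nhds]
  intro ε hε
  obtain ⟨k, hk⟩ := exists_nat_one_div_lt hε
  filter_upwards [h1 k, h2 k] with n a b
  rw [Finset.sum_neg_distrib] at b
  rw [Real.dist_eq, abs_lt]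
  constructor <;> linarith

/-- Conditional expectation agrees on a larger σ-algebra that is equal modulo null sets. -/
lemma condExp_congr_of_le {X : Type*} {m m' : MeasurableSpace X} {mX : MeasurableSpace X} {ρ : Measure X}
    [IsProbabilityMeasure ρ] (hmm : m ≤ m') (hm' : m' ≤ mX)
    (hae : ∀ s, MeasurableSet[m'] s → ∃ t, MeasurableSet[m] t ∧ s =ᵐ[ρ] t)
    {f : X → ℝ} (hf : Integrable f ρ) : ρ[f | m] =ᵐ[ρ] ρ[f | m'] := by
  refine ae_eq_condExp_of_forall_setIntegral_eq hm' hf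
    (fun s _ _ => integrable_condExp.integrableOn) (fun s hs _ => ?_)
    (stronglyMeasurable_condExp.mono hmm).aestronglyMeasurable
  obtain ⟨t, ht, hst⟩ := hae s hs
  rw [setIntegral_congr_set hst, setIntegral_congr_set hst,
    setIntegral_condExp (hmm.trans hm') hf ht]

lemma condExp_congr_null {X : Type*} {m₁ m₂ : MeasurableSpace X} {mX : MeasurableSpace X} {ρ : Measure X}
    [IsProbabilityMeasure ρ] (h₁ : m₁ ≤ mX) (h₂ : m₂ ≤ mX)
    (h12 : ∀ s, MeasurableSet[m₁] s → ∃ t, MeasurableSet[m₂] t ∧ s =ᵐ[ρ] t)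
    (h21 : ∀ s, MeasurableSet[m₂] s → ∃ t, MeasurableSet[m₁] t ∧ s =ᵐ[ρ] t)
    {f : X → ℝ} (hf : Integrable f ρ) : ρ[f | m₁] =ᵐ[ρ] ρ[f | m₂] := by
  have e1 : m₁ ⊔ m₂ ≤ eventuallyMeasurableSpace m₁ (ae ρ) :=
    sup_le le_eventuallyMeasurableSpace h21
  have e2 : m₁ ⊔ m₂ ≤ eventuallyMeasurableSpace m₂ (ae ρ) :=
    sup_le h12 le_eventuallyMeasurableSpace
  exact (condExp_congr_of_le le_sup_left (sup_le h₁ h₂) e1 hf).trans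
    (condExp_congr_of_le le_sup_right (sup_le h₁ h₂) e2 hf).symm

lemma condExp_comp_mp {X : Type*} {F : MeasurableSpace X} {mX : MeasurableSpace X} {ρ : Measure X}
    [IsProbabilityMeasure ρ] (hF : F ≤ mX) {T : X → X}
    (hT : MeasurePreserving T ρ ρ) {f : X → ℝ} (hf : Integrable f ρ) :
    (fun x => (ρ[f | F]) (T x)) =ᵐ[ρ] ρ[fun x => f (T x) | MeasurableSpace.comap T F] := by
  have hle : MeasurableSpace.comap T F ≤ mX :=
    (MeasurableSpace.comap_mono hF).trans hT.measurable.comap_le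
  have key : ∀ (g : X → ℝ), Integrable g ρ → ∀ t, MeasurableSet[mX] t →
      ∫ x in T ⁻¹' t, g (T x) ∂ρ = ∫ x in t, g x ∂ρ := by
    intro g hg t ht
    have h := setIntegral_map (μ := ρ) (g := T) (f := g) ht
      (by rw [hT.map_eq]; exact hg.aestronglyMeasurable) hT.measurable.aemeasurable
    rw [hT.map_eq] at h
    exact h.symm
  refine ae_eq_condExp_of_forall_setIntegral_eq hle (hT.integrable_comp_of_integrable hf)
    (fun s _ _ => (hT.integrable_comp_of_integrable integrable_condExp).integrableOn)
    (fun s hs _ => ?_) ?_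
  · obtain ⟨t, ht, rfl⟩ := hs
    rw [key _ integrable_condExp t (hF t ht), key _ hf t (hF t ht), setIntegral_condExp hF hf ht]
  · refine StronglyMeasurable.aestronglyMeasurable ?_
    exact (stronglyMeasurable_condExp (m := F)).comp_measurable (comap_measurable T)

/-- On a cell of the partition, a function measurable for `F ∨ σ(P)` is `F`-measurable. -/
lemma exists_eq_on_cell {X : Type*} {ι : Type*} {P : ι → Set X}
    (hPd : Pairwise (Function.onFun Disjoint P)) {F : MeasurableSpace X} (i : ι) {h : X → ℝ}
    (hh : Measurable[F ⊔ MeasurableSpace.generateFrom (Set.range P)] h) :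
    ∃ k : X → ℝ, Measurable[F] k ∧ ∀ x ∈ P i, h x = k x := by
  have hle : MeasurableSpace.comap (Subtype.val : P i → X)
      (F ⊔ MeasurableSpace.generateFrom (Set.range P)) ≤
      MeasurableSpace.comap (Subtype.val : P i → X) F := by
    rw [MeasurableSpace.comap_sup, MeasurableSpace.comap_generateFrom]
    refine sup_le le_rfl (MeasurableSpace.generateFrom_le ?_)
    rintro _ ⟨_, ⟨j, rfl⟩, rfl⟩
    by_cases hij : j = i
    · subst hij
      have : (Subtype.val : P j → X) ⁻¹' P j = Set.univ := by ext x; simp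
      rw [this]; exact MeasurableSet.univ
    · have : (Subtype.val : P i → X) ⁻¹' P j = ∅ := by
        ext x
        simp only [Set.mem_preimage, Set.mem_empty_iff_false, iff_false]
        exact fun hx => Set.disjoint_left.1 (hPd hij) hx x.2
      rw [this]; exact @MeasurableSet.empty _ (_)
  have hm : Measurable[MeasurableSpace.comap (Subtype.val : P i → X) F]
      (fun x : P i => h x) := by
    refine Measurable.mono ?_ hle le_rfl
    exact hh.comp (comap_measurable _)
  obtain ⟨k, hk, he⟩ := Measurable.exists_eq_measurable_comp hm
  exact ⟨k, hk, fun x hx => congrFun he ⟨x, hx⟩⟩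

lemma condExp_ind_pos {X : Type*} {F : MeasurableSpace X} {mX : MeasurableSpace X} {ρ : Measure X}
    [IsProbabilityMeasure ρ] (hF : F ≤ mX) {A : Set X}
    (hA : MeasurableSet A) :
    ∀ᵐ x ∂ρ, x ∈ A → 0 < (ρ[A.indicator (fun _ => (1 : ℝ)) | F]) x := by
  set p := ρ[A.indicator (fun _ => (1 : ℝ)) | F] with hp
  have hInt : Integrable (A.indicator (fun _ => (1 : ℝ))) ρ := (integrable_const 1).indicator hA
  have hpm : Measurable[F] p := stronglyMeasurable_condExp.measurable
  have hZ : MeasurableSet[F] {x | p x ≤ 0} := hpm measurableSet_Iic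
  have h1 : ∫ x in {x | p x ≤ 0}, p x ∂ρ = ρ.real (A ∩ {x | p x ≤ 0}) := by
    have he : ∫ x in {x | p x ≤ 0}, p x ∂ρ =
        ∫ x in {x | p x ≤ 0}, A.indicator (fun _ => (1 : ℝ)) x ∂ρ :=
      setIntegral_condExp hF hInt hZ
    rw [he, integral_indicator hA]
    simp [Measure.restrict_restrict hA]
  have h2 : ∫ x in {x | p x ≤ 0}, p x ∂ρ ≤ 0 :=
    setIntegral_nonpos (hF _ hZ) fun x hx => hx
  have h3 : ρ.real (A ∩ {x | p x ≤ 0}) = 0 := le_antisymm (h1 ▸ h2) measureReal_nonneg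
  rw [measureReal_eq_zero_iff] at h3
  filter_upwards [measure_eq_zero_iff_ae_notMem.1 h3] with x hx hxA
  by_contra hc
  exact hx ⟨hxA, not_lt.1 hc⟩

lemma condExp_ind_le_one {X : Type*} {F : MeasurableSpace X} {mX : MeasurableSpace X} {ρ : Measure X}
    [IsProbabilityMeasure ρ] (hF : F ≤ mX) {A : Set X}
    (hA : MeasurableSet A) :
    ∀ᵐ x ∂ρ, 0 ≤ (ρ[A.indicator (fun _ => (1 : ℝ)) | F]) x ∧
      (ρ[A.indicator (fun _ => (1 : ℝ)) | F]) x ≤ 1 := by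
  have hInt : Integrable (A.indicator (fun _ => (1 : ℝ))) ρ := (integrable_const 1).indicator hA
  have h1 : ρ[A.indicator (fun _ => (1 : ℝ)) | F] ≤ᵐ[ρ] ρ[fun _ => (1:ℝ) | F] :=
    condExp_mono hInt (integrable_const 1) (Eventually.of_forall fun x =>
      Set.indicator_le_self' (fun _ _ => zero_le_one) x)
  have h0 : 0 ≤ᵐ[ρ] ρ[A.indicator (fun _ => (1 : ℝ)) | F] :=
    condExp_nonneg (Eventually.of_forall fun x => Set.indicator_nonneg (fun _ _ => zero_le_one) x)
  rw [condExp_const hF] at h1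
  filter_upwards [h0, h1] with x a b using ⟨a, b⟩

lemma condInfo_of_mem {X : Type*} {F : MeasurableSpace X} {mX : MeasurableSpace X} (ρ : Measure X)
    {ι : Type*} [Fintype ι] (P : ι → Set X)
    (hPd : Pairwise (Function.onFun Disjoint P)) {x : X} {i : ι} (hx : x ∈ P i) :
    condInfo ρ F P x = -Real.log ((ρ[(P i).indicator (fun _ => (1 : ℝ)) | F]) x) := by
  unfold condInfo
  rw [Finset.sum_eq_single i]
  · rw [Set.indicator_of_mem hx]
  · intro j _ hj
    exact Set.indicator_of_notMem (fun h => Set.disjoint_left.1 (hPd hj) h hx) _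
  · intro h; exact absurd (Finset.mem_univ i) h

lemma condInfo_measurable {X : Type*} {F : MeasurableSpace X} {mX : MeasurableSpace X} (ρ : Measure X)
    (hF : F ≤ mX) {ι : Type*} [Fintype ι] (P : ι → Set X)
    (hPm : ∀ i, MeasurableSet (P i)) : Measurable (condInfo ρ F P) := by
  have : condInfo ρ F P = fun x => -∑ i, Set.indicator (P i)
      (fun y => Real.log ((ρ[(P i).indicator (fun _ => (1 : ℝ)) | F]) y)) x := by
    ext x; rfl
  rw [this]
  refine (Finset.measurable_sum _ fun i _ => ?_).neg
  exact (Real.measurable_log.comp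
    (stronglyMeasurable_condExp.mono hF).measurable).indicator (hPm i)

lemma log_condExp_integrable {X : Type*} {F : MeasurableSpace X} {mX : MeasurableSpace X} {ρ : Measure X}
    [IsProbabilityMeasure ρ] (hF : F ≤ mX) {A : Set X}
    (hA : MeasurableSet A) :
    Integrable (A.indicator
      (fun y => Real.log ((ρ[A.indicator (fun _ => (1 : ℝ)) | F]) y))) ρ := by
  have hInt : Integrable (A.indicator (fun _ => (1 : ℝ))) ρ := (integrable_const 1).indicator hA
  have hb := condExp_ind_le_one (ρ := ρ) hF hA
  set p := ρ[A.indicator (fun _ => (1 : ℝ)) | F] with hp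
  have hpi : Integrable p ρ := integrable_condExp
  have hpm : Measurable[F] p := stronglyMeasurable_condExp.measurable
  have hpm' : Measurable p := hpm.mono hF le_rfl
  have htrim : (ρ.restrict A).trim hF = (ρ.withDensity fun x => ENNReal.ofReal (p x)).trim hF := by
    refine @Measure.ext _ F _ _ fun s hs => ?_
    rw [trim_measurableSet_eq hF hs, trim_measurableSet_eq hF hs,
      Measure.restrict_apply (hF s hs), withDensity_apply _ (hF s hs),
      ← ofReal_integral_eq_lintegral_ofReal hpi.integrableOn
        (ae_restrict_of_ae (hb.mono fun x hx => hx.1)), hp, setIntegral_condExp hF hInt hs,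
      integral_indicator hA]
    simp [Measure.restrict_restrict hA, Set.inter_comm]
  rw [integrable_indicator_iff hA]
  refine ⟨(Real.measurable_log.comp hpm').aestronglyMeasurable, ?_⟩
  have hφ : Measurable[F] (fun x => ‖Real.log (p x)‖ₑ) :=
    continuous_enorm.measurable.comp (Real.measurable_log.comp hpm)
  have hφ' : Measurable (fun x => ‖Real.log (p x)‖ₑ) := hφ.mono hF le_rfl
  rw [hasFiniteIntegral_iff_enorm, ← lintegral_trim hF hφ, htrim, lintegral_trim hF hφ,
    lintegral_withDensity_eq_lintegral_mul _ hpm'.ennreal_ofReal hφ']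
  refine lt_of_le_of_lt (lintegral_mono_ae (g := fun _ => 1) ?_) (by simp)
  filter_upwards [hb] with x hx
  simp only [Pi.mul_apply]
  rw [← ofReal_norm, ← ENNReal.ofReal_mul hx.1]
  refine ENNReal.ofReal_le_one.2 ?_
  rcases hx.1.eq_or_lt with h0 | h0
  · rw [← h0]; simp
  · rw [Real.norm_eq_abs, abs_of_nonpos (Real.log_nonpos hx.1 hx.2)]
    have h1 := Real.one_sub_inv_le_log_of_pos h0
    have h2 := mul_le_mul_of_nonneg_left h1 h0.le
    rw [mul_sub, mul_inv_cancel₀ h0.ne'] at h2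
    linarith

lemma condInfo_integrable {X : Type*} {F : MeasurableSpace X} {mX : MeasurableSpace X} (ρ : Measure X)
    [IsProbabilityMeasure ρ]
    (hF : F ≤ mX) {ι : Type*} [Fintype ι] (P : ι → Set X)
    (hPm : ∀ i, MeasurableSet (P i)) : Integrable (condInfo ρ F P) ρ := by
  have : condInfo ρ F P = fun x => -∑ i, Set.indicator (P i)
      (fun y => Real.log ((ρ[(P i).indicator (fun _ => (1 : ℝ)) | F]) y)) x := by
    ext x; rfl
  rw [this]
  exact (integrable_finsetSum _ fun i _ => log_condExp_integrable hF (hPm i)).neg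

/-- The chain rule on a cell. -/
lemma condExp_chain {X : Type*} {F : MeasurableSpace X} {mX : MeasurableSpace X} (ρ : Measure X)
    [IsProbabilityMeasure ρ] {T : X → X} (hT : MeasurePreserving T ρ ρ)
    {ι : Type*} [Fintype ι] {P : ι → Set X} (hPm : ∀ i, MeasurableSet (P i))
    (hPd : Pairwise (Function.onFun Disjoint P))
    (hF : F ≤ mX)
    (h1 : ∀ A : Set X, MeasurableSet[MeasurableSpace.comap T F] A →
      ∃ B, MeasurableSet[F ⊔ MeasurableSpace.generateFrom (Set.range P)] B ∧ A =ᵐ[ρ] B)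
    (h2 : ∀ A : Set X, MeasurableSet[F ⊔ MeasurableSpace.generateFrom (Set.range P)] A →
      ∃ B, MeasurableSet[MeasurableSpace.comap T F] B ∧ A =ᵐ[ρ] B)
    (i : ι) {Q : Set X} (hQ : MeasurableSet Q) :
    ∀ᵐ x ∂ρ, x ∈ P i →
      (ρ[(P i ∩ T ⁻¹' Q).indicator (fun _ => (1 : ℝ)) | F]) x =
        (ρ[(P i).indicator (fun _ => (1 : ℝ)) | F]) x *
          (ρ[Q.indicator (fun _ => (1 : ℝ)) | F]) (T x) := by
  have hle1 : MeasurableSpace.comap T F ≤ mX :=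
    (MeasurableSpace.comap_mono hF).trans hT.measurable.comap_le
  have hle2 : F ⊔ MeasurableSpace.generateFrom (Set.range P) ≤ mX :=
    sup_le hF (MeasurableSpace.generateFrom_le (by rintro _ ⟨j, rfl⟩; exact hPm j))
  have hQi : Integrable (Q.indicator (fun _ => (1 : ℝ))) ρ := (integrable_const 1).indicator hQ
  have hQTi : Integrable (fun x => Q.indicator (fun _ => (1 : ℝ)) (T x)) ρ :=
    hT.integrable_comp_of_integrable hQi
  set m₂ := F ⊔ MeasurableSpace.generateFrom (Set.range P) with hm₂
  have hPi2 : MeasurableSet[m₂] (P i) :=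
    (le_sup_right : _ ≤ m₂) _ (MeasurableSpace.measurableSet_generateFrom ⟨i, rfl⟩)
  have hPi : Integrable ((P i).indicator (fun _ => (1 : ℝ))) ρ :=
    (integrable_const 1).indicator (hPm i)
  have e1 := (condExp_comp_mp hF hT hQi).trans (condExp_congr_null hle1 hle2 h1 h2 hQTi)
  set h := ρ[fun x => Q.indicator (fun _ => (1 : ℝ)) (T x) | m₂] with hh
  have hhm : Measurable[m₂] h := stronglyMeasurable_condExp.measurable
  obtain ⟨k, hk, hkh⟩ := exists_eq_on_cell hPd i hhm
  have e2 : ρ[(P i ∩ T ⁻¹' Q).indicator (fun _ => (1 : ℝ)) | m₂] =ᵐ[ρ]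
      k * (P i).indicator (fun _ => (1 : ℝ)) := by
    have a : (P i ∩ T ⁻¹' Q).indicator (fun _ => (1 : ℝ)) =
        (P i).indicator (fun x => Q.indicator (fun _ => (1 : ℝ)) (T x)) := by
      rw [← Set.indicator_indicator]; rfl
    have b : k * (P i).indicator (fun _ => (1 : ℝ)) = (P i).indicator h := by
      ext x
      by_cases hx : x ∈ P i
      · simp [hx, hkh x hx]
      · simp [hx]
    rw [a, b]
    exact condExp_indicator hQTi hPi2
  have hkint : Integrable (k * (P i).indicator (fun _ => (1 : ℝ))) ρ :=
    integrable_condExp.congr e2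
  have e3 : ρ[(P i ∩ T ⁻¹' Q).indicator (fun _ => (1 : ℝ)) | F] =ᵐ[ρ]
      k * ρ[(P i).indicator (fun _ => (1 : ℝ)) | F] :=
    ((condExp_condExp_of_le le_sup_left hle2).symm.trans (condExp_congr_ae e2)).trans
      (condExp_mul_of_stronglyMeasurable_left hk.stronglyMeasurable hkint hPi)
  filter_upwards [e1, e3] with x hx1 hx3 hxP
  rw [hx3, Pi.mul_apply, ← hkh x hxP, ← hx1, mul_comm]

/-- The cells of the refined partition. -/
def cell {X : Type*} {ι : Type*} (T : X → X) (P : ι → Set X) (n : ℕ) (a : Fin n → ι) : Set X :=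
  {z | ∀ j : Fin n, T^[(j : ℕ)] z ∈ P (a j)}

lemma cell_measurable {X : Type*} [MeasurableSpace X] {ι : Type*} {T : X → X}
    (hT : Measurable T) {P : ι → Set X} (hPm : ∀ i, MeasurableSet (P i)) (n : ℕ)
    (a : Fin n → ι) : MeasurableSet (cell T P n a) := by
  have : cell T P n a = ⋂ j : Fin n, T^[(j : ℕ)] ⁻¹' P (a j) := by
    ext x; simp [cell]
  rw [this]
  exact MeasurableSet.iInter fun j => (hT.iterate j) (hPm _)

lemma cell_disjoint {X : Type*} {ι : Type*} {T : X → X} {P : ι → Set X}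
    (hPd : Pairwise (Function.onFun Disjoint P)) (n : ℕ) :
    Pairwise (Function.onFun Disjoint (cell T P n)) := by
  intro a b hab
  refine Set.disjoint_left.2 fun x hxa hxb => hab (funext fun j => ?_)
  by_contra hne
  exact Set.disjoint_left.1 (hPd hne) (hxa j) (hxb j)

lemma cell_cons {X : Type*} {ι : Type*} (T : X → X) (P : ι → Set X) (n : ℕ) (i : ι)
    (b : Fin n → ι) :
    cell T P (n + 1) (Fin.cons i b : Fin (n + 1) → ι) = P i ∩ T ⁻¹' cell T P n b := by
  ext x
  simp [cell, Fin.forall_fin_succ]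

lemma condInfo_cells {X : Type*} {F : MeasurableSpace X} {mX : MeasurableSpace X} (ρ : Measure X)
    [IsProbabilityMeasure ρ] {T : X → X} (hT : MeasurePreserving T ρ ρ)
    {ι : Type*} [Fintype ι] {P : ι → Set X} (hPm : ∀ i, MeasurableSet (P i))
    (hPd : Pairwise (Function.onFun Disjoint P)) (hPu : (⋃ i, P i) = Set.univ)
    (hF : F ≤ mX)
    (h1 : ∀ A : Set X, MeasurableSet[MeasurableSpace.comap T F] A →
      ∃ B, MeasurableSet[F ⊔ MeasurableSpace.generateFrom (Set.range P)] B ∧ A =ᵐ[ρ] B)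
    (h2 : ∀ A : Set X, MeasurableSet[F ⊔ MeasurableSpace.generateFrom (Set.range P)] A →
      ∃ B, MeasurableSet[MeasurableSpace.comap T F] B ∧ A =ᵐ[ρ] B) (n : ℕ) :
    ∀ᵐ x ∂ρ, condInfo ρ F (cell T P n) x =
      ∑ j ∈ Finset.range n, condInfo ρ F P (T^[j] x) := by
  have hidx : ∀ x, ∃ i, x ∈ P i := fun x => by
    have : x ∈ ⋃ i, P i := hPu ▸ Set.mem_univ x
    exact Set.mem_iUnion.1 this
  choose idx hidx using hidx
  induction n with
  | zero =>
    refine Eventually.of_forall fun x => ?_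
    have hu : cell T P 0 (fun j => idx (T^[(j : ℕ)] x)) = Set.univ := by
      ext y; simp [cell]
    rw [condInfo_of_mem ρ _ (cell_disjoint hPd 0) (i := fun j => idx (T^[(j : ℕ)] x))
      (by rw [hu]; trivial), hu, Set.indicator_univ, condExp_const hF]
    simp
  | succ n ih =>
    have c1 : ∀ᵐ x ∂ρ, ∀ i, ∀ b : Fin n → ι, x ∈ P i →
      (ρ[(P i ∩ T ⁻¹' cell T P n b).indicator (fun _ => (1 : ℝ)) | F]) x =
        (ρ[(P i).indicator (fun _ => (1 : ℝ)) | F]) x *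
          (ρ[(cell T P n b).indicator (fun _ => (1 : ℝ)) | F]) (T x) :=
      ae_all_iff.2 fun i => ae_all_iff.2 fun b =>
        condExp_chain ρ hT hPm hPd hF h1 h2 i (cell_measurable hT.measurable hPm n b)
    have c2 : ∀ᵐ x ∂ρ, ∀ i, x ∈ P i → 0 < (ρ[(P i).indicator (fun _ => (1 : ℝ)) | F]) x :=
      ae_all_iff.2 fun i => condExp_ind_pos hF (hPm i)
    have c3 : ∀ᵐ x ∂ρ, ∀ b : Fin n → ι, x ∈ cell T P n b →
        0 < (ρ[(cell T P n b).indicator (fun _ => (1 : ℝ)) | F]) x :=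
      ae_all_iff.2 fun b => condExp_ind_pos hF (cell_measurable hT.measurable hPm n b)
    filter_upwards [c1, c2, hT.quasiMeasurePreserving.ae c3, hT.quasiMeasurePreserving.ae ih]
      with x hx1 hx2 hx3 hx4
    set b : Fin n → ι := fun j => idx (T^[(j : ℕ)] (T x)) with hb
    have hTx : T x ∈ cell T P n b := fun j => hidx _
    have hx : x ∈ P (idx x) := hidx x
    rw [condInfo_of_mem ρ _ (cell_disjoint hPd (n+1))
      (i := (Fin.cons (idx x) b : Fin (n + 1) → ι)) (by rw [cell_cons]; exact ⟨hx, hTx⟩),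
      cell_cons, hx1 _ _ hx, Real.log_mul (hx2 _ hx).ne' (hx3 _ hTx).ne', neg_add,
      ← condInfo_of_mem ρ P hPd hx, ← condInfo_of_mem ρ _ (cell_disjoint hPd n) hTx, hx4,
      Finset.sum_range_succ']
    simp [Function.iterate_succ, add_comm]

/-- Lemma 4.6 of the paper. If `T⁻¹F = F ∨ σ(𝒫)` modulo `ρ`-null sets,
then (1) `I_ρ(𝒫₀^{n-1} | F) = Σ_{j<n} I_ρ(𝒫 | F) ∘ T^j` a.e. for every `n ≥ 1`, and
(2) if `T` is ergodic, `(1/n)·I_ρ(𝒫₀^{n-1} | F)(x) → H_ρ(𝒫 | F)` for `ρ`-a.e. `x`. -/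
theorem stmt14 {X : Type*} [mX : MeasurableSpace X] [StandardBorelSpace X]
    (ρ : Measure X) [IsProbabilityMeasure ρ]
    (T : X ≃ᵐ X) (hT : MeasurePreserving (⇑T) ρ ρ)
    {ι : Type*} [Fintype ι] (P : ι → Set X)
    (hPm : ∀ i, MeasurableSet (P i))
    (hPd : Pairwise (Function.onFun Disjoint P))
    (hPu : (⋃ i, P i) = Set.univ)
    (F : MeasurableSpace X) (hF : F ≤ mX)
    (hcompat1 : ∀ A : Set X, MeasurableSet[MeasurableSpace.comap (⇑T) F] A →
      ∃ B, MeasurableSet[F ⊔ MeasurableSpace.generateFrom (Set.range P)] B ∧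
        ρ (symmDiff A B) = 0)
    (hcompat2 : ∀ A : Set X, MeasurableSet[F ⊔ MeasurableSpace.generateFrom (Set.range P)] A →
      ∃ B, MeasurableSet[MeasurableSpace.comap (⇑T) F] B ∧ ρ (symmDiff A B) = 0) :
    (∀ n : ℕ, 1 ≤ n → ∀ᵐ x ∂ρ,
        condInfo ρ F (fun a : Fin n → ι => {z | ∀ j : Fin n, (⇑T)^[(j : ℕ)] z ∈ P (a j)}) x =
          ∑ j ∈ Finset.range n, condInfo ρ F P ((⇑T)^[j] x)) ∧
      (Ergodic (⇑T) ρ → ∀ᵐ x ∂ρ,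
        Tendsto (fun n : ℕ => (n : ℝ)⁻¹ *
            condInfo ρ F
              (fun a : Fin n → ι => {z | ∀ j : Fin n, (⇑T)^[(j : ℕ)] z ∈ P (a j)}) x)
          atTop (nhds (∫ z, condInfo ρ F P z ∂ρ))) := by
  have hc1 : ∀ A : Set X, MeasurableSet[MeasurableSpace.comap (⇑T) F] A →
      ∃ B, MeasurableSet[F ⊔ MeasurableSpace.generateFrom (Set.range P)] B ∧ A =ᵐ[ρ] B := by
    intro A hA
    obtain ⟨B, hB, h⟩ := hcompat1 A hA
    exact ⟨B, hB, measure_symmDiff_eq_zero_iff.1 h⟩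
  have hc2 : ∀ A : Set X, MeasurableSet[F ⊔ MeasurableSpace.generateFrom (Set.range P)] A →
      ∃ B, MeasurableSet[MeasurableSpace.comap (⇑T) F] B ∧ A =ᵐ[ρ] B := by
    intro A hA
    obtain ⟨B, hB, h⟩ := hcompat2 A hA
    exact ⟨B, hB, measure_symmDiff_eq_zero_iff.1 h⟩
  have key := condInfo_cells ρ hT hPm hPd hPu hF hc1 hc2
  refine ⟨fun n _ => key n, fun hE => ?_⟩
  filter_upwards [ae_all_iff.2 key, birkhoff_ergodic hE (condInfo_measurable ρ hF P hPm)
    (condInfo_integrable ρ hF P hPm)] with x hx hlim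
  refine hlim.congr fun n => ?_
  rw [← hx n]
  rfl
end
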